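/- arXiv:1301.6071 — 2 statements merged into one kernel-verified Lean document; each statement's English description precedes it below -/
import Mathlib

section
/- There is a constant L, depending only on the dimension d, such that for all u, v, s, t > 0 and all x, y ∈ ℝ^d: ∫_{ℝ^d} φ_u(z) φ_v(x−z) φ_s(z) φ_t(y−z) dz ≤ L [ (u+v)/(uv) ]^{d/4} [ (s+t)/(st) ]^{d/4} φ_{u+v}(x) φ_{s+t}(y). -/
open MeasureTheory Filter Finset
open scoped Classical

noncomputable section

abbrev Ed (d : ℕ) := EuclideanSpace ℝ (Fin d)

/-- The centered Gaussian density `φ_t` on `ℝ^d` with covariance `t · Id`. -/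
def gauss (d : ℕ) (t : ℝ) (x : Ed d) : ℝ :=
  (2 * Real.pi * t) ^ (-(d : ℝ) / 2) * Real.exp (-‖x‖ ^ 2 / (2 * t))

/-- Convolution of two functions on `ℝ^d`. -/
def convl (d : ℕ) (f g : Ed d → ℝ) (x : Ed d) : ℝ := ∫ y, f y * g (x - y)

/-- `γ^{(k)}(m) = ∫ |y|^{2k} Γ_m(y) dy`. -/
def gammaMom {d : ℕ} (Γ : ℕ → Ed d → ℝ) (k m : ℕ) : ℝ := ∫ y, ‖y‖ ^ (2 * k) * Γ m y

/-- A rotationally invariant (radial) function on `ℝ^d`. -/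
def Radial {d : ℕ} (f : Ed d → ℝ) : Prop := ∀ x y : Ed d, ‖x‖ = ‖y‖ → f x = f y

/-- A function vanishing at infinity. -/
def VanishAtInfty {d : ℕ} (f : Ed d → ℝ) : Prop := Tendsto f (cocompact (Ed d)) (nhds 0)

/-- Condition B1–B4 on the dominating sequence `Γ`. -/
structure CondB (d : ℕ) (Γ : ℕ → Ed d → ℝ) (χ : ℕ → ℕ → ℝ) (K1 K2 K3 : ℝ) : Prop where
  pos : ∀ m, 1 ≤ m → ∀ x, 0 < Γ m x
  cont : ∀ m, 1 ≤ m → Continuous (Γ m)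
  radial : ∀ m, 1 ≤ m → Radial (Γ m)
  vanish : ∀ m, 1 ≤ m → VanishAtInfty (Γ m)
  integrable : ∀ m, 1 ≤ m → ∀ k, k ≤ 2 → Integrable fun y => ‖y‖ ^ (2 * k) * Γ m y
  chi_pos : ∀ n s, 1 ≤ s → s ≤ n → 0 < χ n s
  chi_symm : ∀ n s, 1 ≤ s → s ≤ n → χ n s = χ n (n - s)
  chi_sum : ∀ n : ℕ, (∑ s ∈ Finset.Ico 1 n, (↑(min s (n - s)) : ℝ) * χ n s) ≤ K1
  conv_le : ∀ m n, 1 ≤ m → 1 ≤ n → ∀ x, convl d (Γ m) (Γ n) x ≤ χ (m + n) m * Γ (m + n) x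
  doubling : ∀ t s : ℕ, 1 ≤ t → t ≤ s → s ≤ 2 * t → ∀ x, Γ s x ≤ K2 * Γ (2 * t) x
  smoothing : ∀ (m : ℕ) (t : ℝ), 1 ≤ m → (m : ℝ) ≤ t → ∀ k, k ≤ 2 → ∀ x,
    (∫ y, gauss d t (x - y) * (‖y‖ ^ (2 * k) * Γ m y)) ≤
      K3 * gammaMom Γ k m * gauss d (t + (m : ℝ)) x
  sum0 : Summable fun n : ℕ => (n : ℝ) * gammaMom Γ 0 n
  sum1 : Summable fun n : ℕ => gammaMom Γ 1 n
  sum2 : Summable fun n : ℕ => gammaMom Γ 2 n / (n : ℝ)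

/-- `b_k = ∫ B_k`. -/
def bInt {d : ℕ} (B : ℕ → Ed d → ℝ) (k : ℕ) : ℝ := ∫ y, B k y

/-- The scalar `b̄_m` with `∫ x xᵀ B_m(x) dx = b̄_m I_d`. -/
def bbar {d : ℕ} (B : ℕ → Ed d → ℝ) (m : ℕ) : ℝ := (∫ y, ‖y‖ ^ 2 * B m y) / d

/-- Regularity of the sequence `B`, dominated by `Γ`. -/
structure BSeq (d : ℕ) (B Γ : ℕ → Ed d → ℝ) : Prop where
  cont : ∀ m, 1 ≤ m → Continuous (B m)
  radial : ∀ m, 1 ≤ m → Radial (B m)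
  vanish : ∀ m, 1 ≤ m → VanishAtInfty (B m)
  integrable : ∀ m, 1 ≤ m → Integrable (B m)
  integrable2 : ∀ m, 1 ≤ m → Integrable fun y => ‖y‖ ^ 2 * B m y
  dom : ∀ m, 1 ≤ m → ∀ x, |B m x| ≤ Γ m x

/-- The recursion for the norming sequence `c`. -/
def cSeq {d : ℕ} (B : ℕ → Ed d → ℝ) (lam : ℝ) (c : ℕ → ℝ) : Prop :=
  c 0 = 1 ∧ ∀ n, 1 ≤ n →
    c n = c (n - 1) + lam * ∑ k ∈ Finset.Icc 1 n, c k * bInt B k * c (n - k)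

/-- The basic convolution recursion for `C` (with `C_0 = δ_0`). -/
def CSeq (d : ℕ) (B : ℕ → Ed d → ℝ) (lam : ℝ) (c : ℕ → ℝ) (C : ℕ → Ed d → ℝ) : Prop :=
  (∀ x, C 1 x = gauss d 1 x + lam * (c 1 * B 1 x)) ∧
  ∀ n, 2 ≤ n → ∀ x, C n x = convl d (C (n - 1)) (gauss d 1) x +
    lam * ((∑ k ∈ Finset.Icc 1 (n - 1), c k * convl d (B k) (C (n - k)) x) + c n * B n x)

/-- The drift parameter `δ`. -/
def deltaParam {d : ℕ} (B : ℕ → Ed d → ℝ) (lam μ : ℝ) (a : ℕ → ℝ) : ℝ :=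
  (μ⁻¹ + lam * ∑' m : ℕ, a (m + 1) * bbar B (m + 1)) /
    (μ⁻¹ + lam * ∑' m : ℕ, ((m : ℝ) + 1) * a (m + 1) * bInt B (m + 1))

def zeta1 {d : ℕ} (Γ : ℕ → Ed d → ℝ) (n : ℕ) : ℝ :=
  1 + ∑ i ∈ Finset.range 3, ∑ m ∈ Finset.Icc 1 n, (m : ℝ) ^ (2 - i) * gammaMom Γ i m

def zeta2 {d : ℕ} (Γ : ℕ → Ed d → ℝ) (n : ℕ) : ℝ :=
  ∑' m : ℕ, (gammaMom Γ 1 (n + m) + (↑(n + m) : ℝ) * gammaMom Γ 0 (n + m))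

def zetaBar {d : ℕ} (Γ : ℕ → Ed d → ℝ) (n : ℕ) : ℝ :=
  (∑ j ∈ Finset.Icc 1 n, zeta1 Γ j) / (n : ℝ) ^ 2 + (∑ j ∈ Finset.Icc 1 n, zeta2 Γ j) / (n : ℝ)

/-- `ψ_n = φ_{nδ(1+ε)}`. -/
def psiFun (d : ℕ) (δv ε : ℝ) (n : ℕ) : Ed d → ℝ := gauss d ((n : ℝ) * δv * (1 + ε))

/-- `f_n = Σ_{s=1}^{[n/2]} s (ψ_s * Γ_{n-s}) + ζ̄(n) ψ_n`. -/
def fFun (d : ℕ) (Γ : ℕ → Ed d → ℝ) (δv ε : ℝ) (n : ℕ) (x : Ed d) : ℝ :=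
  (∑ s ∈ Finset.Icc 1 (n / 2), (s : ℝ) * convl d (psiFun d δv ε s) (Γ (n - s)) x) +
    zetaBar Γ n * psiFun d δv ε n x

/-- `κ(n) = Σ_{s=1}^{[n/2]} ψ_s * Γ_{n-s} + (ζ̄(n)/n) ψ_n`. -/
def kapFun (d : ℕ) (Γ : ℕ → Ed d → ℝ) (δv ε : ℝ) (n : ℕ) (x : Ed d) : ℝ :=
  (∑ s ∈ Finset.Icc 1 (n / 2), convl d (psiFun d δv ε s) (Γ (n - s)) x) +
    zetaBar Γ n / n * psiFun d δv ε n x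

/-- `Δ(k,j)`, with the convention `φ_0 = δ_0` (the `m = k` term is `B_m` itself). -/
def DeltaFun (d : ℕ) (B : ℕ → Ed d → ℝ) (lam μ δv : ℝ) (a : ℕ → ℝ) (k j : ℕ) (x : Ed d) : ℝ :=
  a j * gauss d ((k : ℝ) * δv) x - μ⁻¹ * a (j - 1) * gauss d (((k : ℝ) - 1) * δv + 1) x -
    lam * ∑ m ∈ Finset.Icc 1 j, a m * a (j - m) *
      (if m = k then B m x else convl d (B m) (gauss d (((k : ℝ) - (m : ℝ)) * δv)) x)

/-! Weakly self-avoiding walk. -/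

/-- `I_ρ`, the indicator of the ball of radius `ρ`. -/
def indBall (d : ℕ) (ρ : ℝ) (x : Ed d) : ℝ := if ‖x‖ ≤ ρ then 1 else 0

/-- `K_{λ,ρ}[a,b]`. -/
def Ksaw (d : ℕ) (lam ρ : ℝ) (a b : ℕ) (y : ℕ → Ed d) : ℝ :=
  ∏ p ∈ (Finset.Icc a b ×ˢ Finset.Icc a b).filter fun p => p.1 < p.2,
    (1 - lam * indBall d ρ (y p.2 - y p.1))

/-- `Φ[a,b]`. -/
def PhiProd (d : ℕ) (a b : ℕ) (y : ℕ → Ed d) : ℝ :=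
  ∏ i ∈ Finset.Icc (a + 1) b, gauss d 1 (y i - y (i - 1))

/-- Extend a finite vector `z : Fin L → ℝ^d` to indices `1,…,L` in `ℕ`. -/
def extPath (d L : ℕ) (z : Fin L → Ed d) (i : ℕ) : Ed d :=
  if h : 1 ≤ i ∧ i ≤ L then z ⟨i - 1, by omega⟩ else 0

/-- The path `0, x_1, …, x_{n-1}, x`. -/
def sawPath (d n : ℕ) (x : Ed d) (z : ℕ → Ed d) (j : ℕ) : Ed d :=
  if j = 0 then 0 else if j = n then x else z j

/-- The connectivity function `C_n^{SAW}`. -/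
def Csaw (d : ℕ) (lam ρ : ℝ) (n : ℕ) (x : Ed d) : ℝ :=
  ∫ z : Fin (n - 1) → Ed d,
    Ksaw d lam ρ 0 n (sawPath d n x (extPath d (n - 1) z)) *
      PhiProd d 0 n (sawPath d n x (extPath d (n - 1) z))

/-- `c_n^{SAW} = ∫ C_n^{SAW}`. -/
def csawInt (d : ℕ) (lam ρ : ℝ) (n : ℕ) : ℝ := ∫ x, Csaw d lam ρ n x

/-- Connected graphs on `[a,b]` (in the sense of the lace expansion). -/
def IsConnGraph (a b : ℕ) (G : Finset (ℕ × ℕ)) : Prop :=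
  (∀ p ∈ G, a ≤ p.1 ∧ p.1 < p.2 ∧ p.2 ≤ b) ∧
    (∃ p ∈ G, p.1 = a ∨ p.2 = a) ∧ (∃ p ∈ G, p.1 = b ∨ p.2 = b) ∧
    ∀ c, a < c → c < b → ∃ p ∈ G, p.1 < c ∧ c < p.2

/-- `J[a,b]`, the sum over connected graphs. -/
def Jsaw (d : ℕ) (lam ρ : ℝ) (a b : ℕ) (y : ℕ → Ed d) : ℝ :=
  ∑ G ∈ ((Finset.Icc a b ×ˢ Finset.Icc a b).powerset).filter (IsConnGraph a b),
    ∏ p ∈ G, -(lam * indBall d ρ (y p.2 - y p.1))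

/-- The lace functions `Π_n`. -/
def Pisaw (d : ℕ) (lam ρ : ℝ) (n : ℕ) (x : Ed d) : ℝ :=
  ∫ z : Fin (n - 1) → Ed d,
    Jsaw d lam ρ 0 n (sawPath d n x (extPath d (n - 1) z)) *
      PhiProd d 0 n (sawPath d n x (extPath d (n - 1) z))

/-- The error rates `r_n`. -/
def rseq (d n : ℕ) : ℝ :=
  if d = 5 then (n : ℝ) ^ (-(1 : ℝ) / 2)
  else if d = 6 then Real.log n / n
  else (n : ℝ)⁻¹

/-- `Γ_n = K n^{-d/2} Σ_{k=1}^n k^{1-d/2} φ_{2k/5}`. -/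
def GammaSAW (d : ℕ) (K : ℝ) (n : ℕ) (x : Ed d) : ℝ :=
  K * (n : ℝ) ^ (-(d : ℝ) / 2) *
    ∑ k ∈ Finset.Icc 1 n, (k : ℝ) ^ (1 - (d : ℝ) / 2) * gauss d (2 * k / 5) x

/-- `χ_n(s) = LK (n/(s(n-s)))^{d/2}`. -/
def chiSAW (d : ℕ) (LK : ℝ) (n s : ℕ) : ℝ :=
  LK * ((n : ℝ) / ((s : ℝ) * (↑(n - s) : ℝ))) ^ ((d : ℝ) / 2)

/-! Laces. -/

/-- `β(j)`: index of the bond of the basic `N`-lace containing the vertex `j`. -/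
def betaIdx (N j : ℕ) : ℕ :=
  if j = 0 then 1 else if j = 2 * N - 1 then N else if j % 2 = 0 then j / 2 else (j + 3) / 2

/-- `Φ^{(ν)}_{N,m,t}(x₁,…,x_{N-1})` (with `x 0 = 0` as convention on the argument). -/
def PhiLace (d N : ℕ) (ν : ℝ) (m : Fin (2 * N - 1) → ℕ) (t : Fin (2 * N - 1) → ℝ)
    (x : ℕ → Ed d) : ℝ :=
  ∏ i : Fin (2 * N - 1),
    gauss d (ν * m i + t i) (x (betaIdx N ((i : ℕ) + 1) - 1) - x (betaIdx N (i : ℕ) - 1))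

/-- `L^{(N)}_r[0,n]`: interdistance vectors summing to `n`, bounded below by `r`. -/
def laceFinset (len n : ℕ) (r : Fin len → ℕ) : Finset (Fin len → ℕ) :=
  (Fintype.piFinset fun _ => Finset.range (n + 1)).filter fun m =>
    (∑ i, m i) = n ∧ ∀ i, r i ≤ m i

/-- Extend a vector `Fin len → ℕ` to indices `1,…,len`. -/
def extVec (len : ℕ) (m : Fin len → ℕ) (i : ℕ) : ℕ :=
  if h : 1 ≤ i ∧ i ≤ len then m ⟨i - 1, by omega⟩ else 0

/-- The vertices of a lace diagram, collapsing steps with `m_i = 0` (`G_0 = δ_0`). -/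
def laceVertex (d N : ℕ) (m : ℕ → ℕ) (x : Ed d) (z : ℕ → Ed d) : ℕ → Ed d
  | 0 => 0
  | i + 1 =>
    if i + 1 = 2 * N - 1 then x
    else if m (i + 1) = 0 then laceVertex d N m x z i
    else z (i + 1)

/-- Lower endpoint `i̲` of the `i`-th bond of the basic `N`-lace. -/
def bLow (i : ℕ) : ℕ := if i = 1 then 0 else 2 * i - 3

/-- Upper endpoint `ī` of the `i`-th bond of the basic `N`-lace. -/
def bHigh (N i : ℕ) : ℕ := if i = N then 2 * N - 1 else 2 * i

/-- `Ξ_ℓ(G,ρ)(x)`; coordinates with `m_i = 0` are collapsed (the `δ_0` convention),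
and the corresponding unused integration variables are normalized away by a
standard Gaussian factor. -/
def XiLace (d N : ℕ) (G : ℕ → Ed d → ℝ) (ρ : ℝ) (m : Fin (2 * N - 1) → ℕ) (x : Ed d) : ℝ :=
  ∫ z : Fin (2 * N - 2) → Ed d,
    (∏ i ∈ Finset.Icc 1 (2 * N - 1),
      if extVec (2 * N - 1) m i = 0 then gauss d 1 (extPath d (2 * N - 2) z i)
      else
        G (extVec (2 * N - 1) m i)
          (laceVertex d N (extVec (2 * N - 1) m) x (extPath d (2 * N - 2) z) i -
            laceVertex d N (extVec (2 * N - 1) m) x (extPath d (2 * N - 2) z) (i - 1))) *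
    ∏ i ∈ Finset.Icc 1 N,
      indBall d ρ
        (laceVertex d N (extVec (2 * N - 1) m) x (extPath d (2 * N - 2) z) (bHigh N i) -
          laceVertex d N (extVec (2 * N - 1) m) x (extPath d (2 * N - 2) z) (bLow i))

/-- The natural restriction vector `r⁰` for `N`-laces (`0`-indexed). -/
def r0vec (N : ℕ) (j : Fin (2 * N - 1)) : ℕ :=
  if (j : ℕ) % 2 = 1 ∨ (j : ℕ) = 0 ∨ (j : ℕ) = 2 * N - 2 then 1 else 0

/-- `ξ_n^{(N)}(G,ρ) = Σ_{ℓ ∈ L^{(N)}[0,n]} Ξ_ℓ(G,ρ)`. -/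
def xiLace (d N : ℕ) (G : ℕ → Ed d → ℝ) (ρ : ℝ) (n : ℕ) (x : Ed d) : ℝ :=
  ∑ m ∈ laceFinset (2 * N - 1) n (r0vec N), XiLace d N G ρ m x

/-- `Γ_n = n^{-a} φ_{n/2}`. -/
def GammaPoly (d : ℕ) (a : ℝ) (n : ℕ) (x : Ed d) : ℝ := (n : ℝ) ^ (-a) * gauss d ((n : ℝ) / 2) x

lemma gauss_nonneg (d : ℕ) {t : ℝ} (ht : 0 < t) (x : Ed d) : 0 ≤ gauss d t x := by
  unfold gauss
  positivity

lemma gauss_le (d : ℕ) {t : ℝ} (ht : 0 < t) (x : Ed d) :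
    gauss d t x ≤ (2 * Real.pi * t) ^ (-(d : ℝ) / 2) := by
  unfold gauss
  refine mul_le_of_le_one_right (by positivity) (Real.exp_le_one_iff.2 ?_)
  rw [neg_div, neg_nonpos]
  positivity

lemma integral_gauss (d : ℕ) {t : ℝ} (ht : 0 < t) : ∫ x, gauss d t x = 1 := by
  have hb : 0 < 1 / (2 * t) := by positivity
  have hexp : ∀ x : Ed d, -‖x‖ ^ 2 / (2 * t) = -(1 / (2 * t)) * ‖x‖ ^ 2 := fun x => by ring
  unfold gauss
  simp_rw [hexp]
  rw [integral_const_mul, GaussianFourier.integral_rexp_neg_mul_sq_norm hb,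
    finrank_euclideanSpace_fin, show Real.pi / (1 / (2 * t)) = 2 * Real.pi * t by field_simp,
    ← Real.rpow_add (by positivity), neg_div, neg_add_cancel, Real.rpow_zero]

lemma integrable_gauss (d : ℕ) {t : ℝ} (ht : 0 < t) : Integrable (gauss d t) :=
  .of_integral_ne_zero (by simp [integral_gauss d ht])

/-- The bridge identity: two Gaussian factors rewritten as the Gaussian of the sum of the
variances times a translated Gaussian in the intermediate variable. -/
lemma gauss_mul_gauss_sub (d : ℕ) {u v : ℝ} (hu : 0 < u) (hv : 0 < v) (x z : Ed d) :
    gauss d u z * gauss d v (x - z) =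
      gauss d (u + v) x * gauss d (u * v / (u + v)) (z - (u / (u + v)) • x) := by
  have huv : 0 < u + v := add_pos hu hv
  have hnorm : (2 * Real.pi * u) ^ (-(d : ℝ) / 2) * (2 * Real.pi * v) ^ (-(d : ℝ) / 2) =
      (2 * Real.pi * (u + v)) ^ (-(d : ℝ) / 2) *
        (2 * Real.pi * (u * v / (u + v))) ^ (-(d : ℝ) / 2) := by
    rw [← Real.mul_rpow (by positivity) (by positivity),
      ← Real.mul_rpow (by positivity) (by positivity)]
    congr 1
    field_simp
  have hexp : -‖z‖ ^ 2 / (2 * u) + -‖x - z‖ ^ 2 / (2 * v) =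
      -‖x‖ ^ 2 / (2 * (u + v)) +
        -‖z - (u / (u + v)) • x‖ ^ 2 / (2 * (u * v / (u + v))) := by
    rw [norm_sub_sq_real, norm_sub_sq_real, real_inner_smul_right, norm_smul, mul_pow,
      Real.norm_eq_abs, sq_abs, real_inner_comm]
    field_simp
    ring
  unfold gauss
  rw [mul_mul_mul_comm, hnorm, ← Real.exp_add, hexp, Real.exp_add, mul_mul_mul_comm]

lemma integral_gauss_sub_mul_gauss_sub_le_of_le (d : ℕ) {p q : ℝ} (hp : 0 < p) (hpq : p ≤ q)
    (a b : Ed d) :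
    ∫ z, gauss d p (z - a) * gauss d q (z - b) ≤
      (2 * Real.pi) ^ (-(d : ℝ) / 2) * p⁻¹ ^ ((d : ℝ) / 4) * q⁻¹ ^ ((d : ℝ) / 4) := by
  have hq : 0 < q := hp.trans_le hpq
  calc ∫ z, gauss d p (z - a) * gauss d q (z - b)
      ≤ ∫ z, gauss d p (z - a) * (2 * Real.pi * q) ^ (-(d : ℝ) / 2) := by
        refine integral_mono_of_nonneg
          (ae_of_all _ fun z => mul_nonneg (gauss_nonneg d hp _) (gauss_nonneg d hq _))
          (((integrable_gauss d hp).comp_sub_right a).mul_const _)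
          (ae_of_all _ fun z =>
            mul_le_mul_of_nonneg_left (gauss_le d hq _) (gauss_nonneg d hp _))
    _ = (2 * Real.pi * q) ^ (-(d : ℝ) / 2) := by
        rw [integral_mul_const, integral_sub_right_eq_self (gauss d p) a, integral_gauss d hp,
          one_mul]
    _ = (2 * Real.pi) ^ (-(d : ℝ) / 2) * q⁻¹ ^ ((d : ℝ) / 4) * q⁻¹ ^ ((d : ℝ) / 4) := by
        rw [Real.mul_rpow (by positivity) hq.le, mul_assoc, ← Real.rpow_add (by positivity),
          Real.inv_rpow hq.le, ← Real.rpow_neg hq.le]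
        ring_nf
    _ ≤ _ := by gcongr

lemma integral_gauss_sub_mul_gauss_sub_le (d : ℕ) {p q : ℝ} (hp : 0 < p) (hq : 0 < q)
    (a b : Ed d) :
    ∫ z, gauss d p (z - a) * gauss d q (z - b) ≤
      (2 * Real.pi) ^ (-(d : ℝ) / 2) * p⁻¹ ^ ((d : ℝ) / 4) * q⁻¹ ^ ((d : ℝ) / 4) := by
  rcases le_total p q with h | h
  · exact integral_gauss_sub_mul_gauss_sub_le_of_le d hp h a b
  · simpa only [mul_comm, mul_left_comm, mul_assoc] using
      integral_gauss_sub_mul_gauss_sub_le_of_le d hq h b a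

/-- Product of two Gaussian convolutions: the Cauchy–Schwarz estimate. -/
theorem gaussian_four_fold_bound (d : ℕ) (hd : 1 ≤ d) :
    ∃ L > (0 : ℝ), ∀ u v s t : ℝ, 0 < u → 0 < v → 0 < s → 0 < t → ∀ x y : Ed d,
      (∫ z, gauss d u z * gauss d v (x - z) * gauss d s z * gauss d t (y - z)) ≤
        L * ((u + v) / (u * v)) ^ ((d : ℝ) / 4) * ((s + t) / (s * t)) ^ ((d : ℝ) / 4) *
          gauss d (u + v) x * gauss d (s + t) y := by
  refine ⟨(2 * Real.pi) ^ (-(d : ℝ) / 2), by positivity, fun u v s t hu hv hs ht x y => ?_⟩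
  have hint : ∀ z, gauss d u z * gauss d v (x - z) * gauss d s z * gauss d t (y - z) =
      gauss d (u + v) x * gauss d (s + t) y *
        (gauss d (u * v / (u + v)) (z - (u / (u + v)) • x) *
          gauss d (s * t / (s + t)) (z - (s / (s + t)) • y)) := fun z => by
    rw [mul_assoc, gauss_mul_gauss_sub d hu hv, gauss_mul_gauss_sub d hs ht, mul_mul_mul_comm]
  simp_rw [hint]
  rw [integral_const_mul]
  have hle := integral_gauss_sub_mul_gauss_sub_le d (p := u * v / (u + v))
    (q := s * t / (s + t)) (by positivity) (by positivity) ((u / (u + v)) • x)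
    ((s / (s + t)) • y)
  rw [inv_div, inv_div] at hle
  refine (mul_le_mul_of_nonneg_left hle (mul_nonneg (gauss_nonneg d (add_pos hu hv) x)
    (gauss_nonneg d (add_pos hs ht) y))).trans_eq ?_
  ring
end
end

section
/- For every n ≥ 1, the connectivity functions of the weakly self-avoiding walk satisfy the lace-expansion recursion C_n = C_{n−1} * φ + Σ_{k=1}^{n} Π_k * C_{n−k}, i.e. for all x ∈ ℝ^d: C_n(x) = (C_{n−1} * φ)(x) + Σ_{k=1}^{n−1} (Π_k * C_{n−k})(x) + Π_n(x) (the k = n term being Π_n * δ_0 = Π_n). -/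
open MeasureTheory Filter Finset
open scoped Classical

noncomputable section

/-- The edges `(s, t)` with `a ≤ s < t ≤ b`. -/
def edgeFinset (a b : ℕ) : Finset (ℕ × ℕ) :=
  (Finset.Icc a b ×ˢ Finset.Icc a b).filter fun p => p.1 < p.2

theorem mem_edgeFinset {a b : ℕ} {p : ℕ × ℕ} :
    p ∈ edgeFinset a b ↔ a ≤ p.1 ∧ p.1 < p.2 ∧ p.2 ≤ b := by
  simp only [edgeFinset, mem_filter, mem_product, mem_Icc]
  omega

/-- The connected graphs on `[a,b]`. -/
def connGraphs (a b : ℕ) : Finset (Finset (ℕ × ℕ)) :=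
  ((Finset.Icc a b ×ˢ Finset.Icc a b).powerset).filter (IsConnGraph a b)

theorem mem_connGraphs {a b : ℕ} {G : Finset (ℕ × ℕ)} :
    G ∈ connGraphs a b ↔ IsConnGraph a b G := by
  simp only [connGraphs, mem_filter, mem_powerset, and_iff_right_iff_imp]
  intro h p hp
  have := h.1 p hp
  simp only [mem_product, mem_Icc]
  omega

/-- A graph on `[0,n]` with an edge starting at `0` decomposes into the connected component of `0`
and a graph on the remaining interval. -/
theorem exists_connGraph_split {n : ℕ} {G : Finset (ℕ × ℕ)} (hG : G ⊆ edgeFinset 0 n)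
    (h0 : ∃ p ∈ G, p.1 = 0) :
    ∃ k ∈ Finset.Icc 1 n, IsConnGraph 0 k (G.filter fun p => p.2 ≤ k) ∧
      G.filter (fun p => ¬ p.2 ≤ k) ⊆ edgeFinset k n := by
  have hE : ∀ p ∈ G, p.1 < p.2 ∧ p.2 ≤ n := fun p hp => (mem_edgeFinset.1 (hG hp)).2
  obtain ⟨p₀, hp₀, hp₀0⟩ := h0
  have hn : 1 ≤ n := by have := hE p₀ hp₀; omega
  have hex : ∃ k, 1 ≤ k ∧ ∀ p ∈ G, ¬ (p.1 < k ∧ k < p.2) :=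
    ⟨n, hn, fun p hp => by have := hE p hp; omega⟩
  set k := Nat.find hex
  obtain ⟨hk1, hkG⟩ : 1 ≤ k ∧ ∀ p ∈ G, ¬ (p.1 < k ∧ k < p.2) := Nat.find_spec hex
  have hkn : k ≤ n := Nat.find_min' hex ⟨hn, fun p hp => by have := hE p hp; omega⟩
  have hmin : ∀ c, 1 ≤ c → c < k → ∃ p ∈ G, p.1 < c ∧ c < p.2 := by
    intro c hc1 hck
    have := Nat.find_min hex hck
    push Not at this
    exact this hc1
  have hcross : ∀ c, 1 ≤ c → c < k → ∃ p ∈ G.filter (fun p => p.2 ≤ k), p.1 < c ∧ c < p.2 := by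
    intro c hc1 hck
    obtain ⟨p, hp, h⟩ := hmin c hc1 hck
    exact ⟨p, mem_filter.2 ⟨hp, by have := hkG p hp; omega⟩, h⟩
  have hp₀k : p₀ ∈ G.filter (fun p => p.2 ≤ k) :=
    mem_filter.2 ⟨hp₀, by have := hkG p₀ hp₀; omega⟩
  refine ⟨k, Finset.mem_Icc.2 ⟨hk1, hkn⟩, ⟨?_, ⟨p₀, hp₀k, Or.inl hp₀0⟩, ?_, ?_⟩, ?_⟩
  · intro p hp
    obtain ⟨hpG, hpk⟩ := mem_filter.1 hp
    exact ⟨Nat.zero_le _, (hE p hpG).1, hpk⟩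
  · rcases hk1.eq_or_lt with h1 | h1
    · refine ⟨p₀, hp₀k, Or.inr ?_⟩
      have := (mem_filter.1 hp₀k).2
      have := hE p₀ hp₀
      omega
    · obtain ⟨p, hp, h⟩ := hcross (k - 1) (by omega) (by omega)
      refine ⟨p, hp, Or.inr ?_⟩
      have := (mem_filter.1 hp).2
      omega
  · intro c hc hck
    exact hcross c hc hck
  · intro p hp
    obtain ⟨hpG, hpk⟩ := mem_filter.1 hp
    have := hkG p hpG
    have := hE p hpG
    exact mem_edgeFinset.2 ⟨by omega, by omega, by omega⟩

theorem IsConnGraph.filter_union {k n : ℕ} {G₁ G₂ : Finset (ℕ × ℕ)} (h₁ : IsConnGraph 0 k G₁)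
    (h₂ : G₂ ⊆ edgeFinset k n) : (G₁ ∪ G₂).filter (fun p => p.2 ≤ k) = G₁ ∧
      (G₁ ∪ G₂).filter (fun p => ¬ p.2 ≤ k) = G₂ := by
  have hG₁ : ∀ p ∈ G₁, p.2 ≤ k := fun p hp => (h₁.1 p hp).2.2
  have hG₂ : ∀ p ∈ G₂, ¬ p.2 ≤ k := fun p hp => by
    have := mem_edgeFinset.1 (h₂ hp)
    omega
  constructor <;> ext p <;> simp only [mem_filter, mem_union] <;> grind

theorem IsConnGraph.le_of_union_eq {k k' n : ℕ} {G₁ G₂ G₁' G₂' : Finset (ℕ × ℕ)}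
    (hk : 1 ≤ k) (h₁ : IsConnGraph 0 k G₁) (h₂ : G₂ ⊆ edgeFinset k n)
    (h₁' : IsConnGraph 0 k' G₁') (h : G₁ ∪ G₂ = G₁' ∪ G₂') : k' ≤ k := by
  by_contra! hlt
  obtain ⟨p, hp, hpk⟩ := h₁'.2.2.2 k hk hlt
  have hpu : p ∈ G₁ ∪ G₂ := h ▸ mem_union_left _ hp
  rcases mem_union.1 hpu with hp | hp
  · have := h₁.1 p hp
    omega
  · have := mem_edgeFinset.1 (h₂ hp)
    omega

/-- The lace-expansion identity for arbitrary edge weights. -/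
theorem prod_one_add_edge_eq {R : Type*} [CommRing R] (u : ℕ × ℕ → R) (n : ℕ) :
    ∏ p ∈ edgeFinset 0 n, (1 + u p) = ∏ p ∈ edgeFinset 1 n, (1 + u p) +
      ∑ k ∈ Finset.Icc 1 n, (∑ G ∈ connGraphs 0 k, ∏ p ∈ G, u p) *
        ∏ p ∈ edgeFinset k n, (1 + u p) := by
  simp only [Finset.prod_one_add]
  rw [← Finset.sum_filter_add_sum_filter_not (edgeFinset 0 n).powerset
    (fun G => ∀ p ∈ G, p.1 ≠ 0)]
  congr 1
  · refine Finset.sum_congr ?_ fun _ _ => rfl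
    ext G
    simp only [mem_filter, mem_powerset, Finset.subset_iff, mem_edgeFinset]
    constructor
    · rintro ⟨h, h'⟩ p hp
      have := h hp
      have := h' p hp
      omega
    · intro h
      refine ⟨fun p hp => ?_, fun p hp => ?_⟩ <;> have := h hp <;> omega
  · simp only [Finset.sum_mul_sum, ← Finset.sum_product']
    rw [Finset.sum_sigma']
    symm
    refine Finset.sum_bij (fun q _ => q.2.1 ∪ q.2.2) ?_ ?_ ?_ ?_
    · rintro ⟨k, G₁, G₂⟩ hq
      simp only [mem_sigma, mem_Icc, mem_product, mem_connGraphs, mem_powerset] at hq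
      obtain ⟨⟨hk1, hkn⟩, h₁, h₂⟩ := hq
      simp only [mem_filter, mem_powerset]
      refine ⟨?_, ?_⟩
      · intro p hp
        rcases mem_union.1 hp with hp | hp
        · have := h₁.1 p hp
          exact mem_edgeFinset.2 ⟨by omega, by omega, by omega⟩
        · have := mem_edgeFinset.1 (h₂ hp)
          exact mem_edgeFinset.2 ⟨by omega, by omega, by omega⟩
      · obtain ⟨p, hp, h⟩ := h₁.2.1
        have := h₁.1 p hp
        intro hall
        exact hall p (mem_union_left _ hp) (by omega)
    · rintro ⟨k, G₁, G₂⟩ hq ⟨k', G₁', G₂'⟩ hq' h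
      simp only [mem_sigma, mem_Icc, mem_product, mem_connGraphs, mem_powerset] at hq hq' h
      obtain ⟨⟨hk1, hkn⟩, h₁, h₂⟩ := hq
      obtain ⟨⟨hk1', hkn'⟩, h₁', h₂'⟩ := hq'
      obtain rfl : k = k' := le_antisymm (h₁'.le_of_union_eq hk1' h₂' h₁ h.symm)
        (h₁.le_of_union_eq hk1 h₂ h₁' h)
      obtain ⟨e₁, e₂⟩ := h₁.filter_union h₂
      obtain ⟨e₁', e₂'⟩ := h₁'.filter_union h₂'
      rw [h] at e₁ e₂
      rw [← e₁, ← e₂, e₁', e₂']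
    · intro G hG
      simp only [mem_filter, mem_powerset] at hG
      obtain ⟨hGE, hG0⟩ := hG
      push Not at hG0
      obtain ⟨k, hk, h₁, h₂⟩ := exists_connGraph_split hGE hG0
      refine ⟨⟨k, G.filter fun p => p.2 ≤ k, G.filter fun p => ¬ p.2 ≤ k⟩, ?_, ?_⟩
      · simp only [mem_sigma, mem_product, mem_connGraphs, mem_powerset]
        exact ⟨hk, h₁, h₂⟩
      · exact Finset.filter_union_filter_not_eq _ G
    · rintro ⟨k, G₁, G₂⟩ hq
      simp only [mem_sigma, mem_Icc, mem_product, mem_connGraphs, mem_powerset] at hq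
      obtain ⟨-, h₁, h₂⟩ := hq
      refine (Finset.prod_union (Finset.disjoint_left.2 fun p hp hp' => ?_)).symm
      have := h₁.1 p hp
      have := mem_edgeFinset.1 (h₂ hp')
      omega

theorem Ksaw_eq_add_sum (d : ℕ) (lam ρ : ℝ) (n : ℕ) (y : ℕ → Ed d) :
    Ksaw d lam ρ 0 n y = Ksaw d lam ρ 1 n y +
      ∑ k ∈ Finset.Icc 1 n, Jsaw d lam ρ 0 k y * Ksaw d lam ρ k n y := by
  simpa only [← sub_eq_add_neg, Ksaw, Jsaw, edgeFinset, connGraphs] using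
    prod_one_add_edge_eq (fun p => -(lam * indBall d ρ (y p.2 - y p.1))) n

theorem continuous_gauss (d : ℕ) (t : ℝ) : Continuous (gauss d t) := by
  unfold gauss
  fun_prop

theorem gauss_one_nonneg (d : ℕ) (x : Ed d) : 0 ≤ gauss d 1 x := by
  unfold gauss
  positivity

theorem gauss_one_le (d : ℕ) (x : Ed d) : gauss d 1 x ≤ (2 * Real.pi * 1) ^ (-(d : ℝ) / 2) := by
  unfold gauss
  refine mul_le_of_le_one_right (by positivity) (Real.exp_le_one_iff.2 ?_)
  rw [neg_div, neg_nonpos]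
  positivity

theorem integrable_gauss_one (d : ℕ) : Integrable (gauss d 1) := by
  have h := (GaussianFourier.integrable_cexp_neg_mul_sq_norm_add (V := Ed d) (b := (1 / 2 : ℂ))
    (by norm_num) 0 0).norm
  refine (h.const_mul ((2 * Real.pi * 1) ^ (-(d : ℝ) / 2))).congr (ae_of_all _ fun x => ?_)
  simp only [gauss, Complex.norm_exp]
  congr 2
  simp only [zero_mul, add_zero, ← Complex.ofReal_pow]
  rw [show (-(1 / 2 : ℂ) * ((‖x‖ ^ 2 : ℝ) : ℂ)) = ((-(1 / 2) * ‖x‖ ^ 2 : ℝ) : ℂ) by push_cast; ring,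
    Complex.ofReal_re]
  ring

theorem extPath_zero (d L : ℕ) (z : Fin L → Ed d) : extPath d L z 0 = 0 := by
  simp [extPath]

theorem extPath_cons_one (d L : ℕ) (y : Ed d) (v : Fin L → Ed d) :
    extPath d (L + 1) (Fin.cons y v) 1 = y := by
  simp [extPath]

theorem extPath_cons_add_two (d L : ℕ) (y : Ed d) (v : Fin L → Ed d) (i : ℕ) :
    extPath d (L + 1) (Fin.cons y v) (i + 2) = extPath d L v (i + 1) := by
  unfold extPath
  by_cases h : i + 1 ≤ L
  · rw [dif_pos ⟨by omega, by omega⟩, dif_pos ⟨by omega, h⟩]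
    exact Fin.cons_succ (α := fun _ => Ed d) y v ⟨i, by omega⟩
  · rw [dif_neg (by omega), dif_neg (by omega)]

theorem extPath_append_left (d a b : ℕ) (u : Fin a → Ed d) (w : Fin b → Ed d) {j : ℕ}
    (hj : j ≤ a) : extPath d (a + b) (Fin.append u w) j = extPath d a u j := by
  unfold extPath
  by_cases h : 1 ≤ j
  · rw [dif_pos ⟨h, by omega⟩, dif_pos ⟨h, hj⟩]
    exact Fin.append_left u w ⟨j - 1, by omega⟩
  · rw [dif_neg (by omega), dif_neg (by omega)]

theorem extPath_append_right (d a b : ℕ) (u : Fin a → Ed d) (w : Fin b → Ed d) {j : ℕ}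
    (hj : 1 ≤ j) : extPath d (a + b) (Fin.append u w) (a + j) = extPath d b w j := by
  unfold extPath
  by_cases h : j ≤ b
  · rw [dif_pos ⟨by omega, by omega⟩, dif_pos ⟨hj, h⟩]
    convert Fin.append_right u w ⟨j - 1, by omega⟩ using 2
    ext
    simp only [Fin.val_natAdd]
    omega
  · rw [dif_neg (by omega), dif_neg (by omega)]

theorem extPath_sub_const (d L : ℕ) (v : Fin L → Ed d) (y : Ed d) {j : ℕ} (h1 : 1 ≤ j)
    (hL : j ≤ L) : extPath d L (v - fun _ => y) j = extPath d L v j - y := by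
  simp [extPath, h1, hL]

/-- Up to the splitting time `a + 1`, the glued path is the first path. -/
theorem sawPath_append_cons_left (d a b : ℕ) (x y : Ed d) (u : Fin a → Ed d) (v : Fin b → Ed d)
    {j : ℕ} (hj : j ≤ a + 1) :
    sawPath d (a + (b + 1) + 1) x (extPath d (a + (b + 1)) (Fin.append u (Fin.cons y v))) j =
      sawPath d (a + 1) y (extPath d a u) j := by
  unfold sawPath
  by_cases h0 : j = 0
  · simp [h0]
  rw [if_neg h0, if_neg h0, if_neg (by omega)]
  by_cases h1 : j = a + 1
  · rw [if_pos h1, h1, extPath_append_right d a (b + 1) _ _ le_rfl, extPath_cons_one]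
  · rw [if_neg h1, extPath_append_left d a (b + 1) _ _ (by omega)]

/-- After the splitting time `a + 1`, the glued path is a translate of the second path. -/
theorem sawPath_append_cons_right (d a b : ℕ) (x y : Ed d) (u : Fin a → Ed d) (v : Fin b → Ed d)
    {i : ℕ} (hi : i ≤ b + 1) :
    sawPath d (a + (b + 1) + 1) x (extPath d (a + (b + 1)) (Fin.append u (Fin.cons y v)))
        (a + 1 + i) - y =
      sawPath d (b + 1) (x - y) (extPath d b (v - fun _ => y)) i := by
  unfold sawPath
  rw [if_neg (by omega)]
  by_cases h1 : i = b + 1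
  · rw [if_pos (by omega), if_neg (by omega), if_pos h1]
  rw [if_neg (by omega), if_neg h1, add_assoc, extPath_append_right d a (b + 1) _ _ (by omega)]
  obtain _ | i := i
  · simp [extPath_cons_one]
  · rw [if_neg (by omega), extPath_sub_const d b v y (by omega) (by omega),
      show 1 + (i + 1) = i + 2 by omega, extPath_cons_add_two]

theorem Jsaw_congr {d : ℕ} {lam ρ : ℝ} {a b : ℕ} {y y' : ℕ → Ed d}
    (h : ∀ j ≤ b, y j = y' j) : Jsaw d lam ρ a b y = Jsaw d lam ρ a b y' := by
  refine Finset.sum_congr rfl fun G hG => Finset.prod_congr rfl fun p hp => ?_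
  have := (mem_connGraphs.1 hG).1 p hp
  rw [h p.1 (by omega), h p.2 (by omega)]

theorem PhiProd_congr {d a b : ℕ} {y y' : ℕ → Ed d}
    (h : ∀ j ≤ b, y j = y' j) : PhiProd d a b y = PhiProd d a b y' := by
  refine Finset.prod_congr rfl fun i hi => ?_
  rw [Finset.mem_Icc] at hi
  rw [h i (by omega), h (i - 1) (by omega)]

theorem PhiProd_mul_PhiProd {d a b c : ℕ} (hab : a ≤ b) (hbc : b ≤ c) (y : ℕ → Ed d) :
    PhiProd d a b y * PhiProd d b c y = PhiProd d a c y := by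
  unfold PhiProd
  rw [← Finset.prod_union]
  · refine Finset.prod_congr ?_ fun _ _ => rfl
    ext i
    simp only [mem_union, Finset.mem_Icc]
    omega
  · refine Finset.disjoint_left.2 fun i hi hi' => ?_
    rw [Finset.mem_Icc] at hi hi'
    omega

/-- Translation invariance of `Φ` in space and in the index. -/
theorem PhiProd_shift {d k m n : ℕ} (hn : n = k + m) {y y' : ℕ → Ed d} (c : Ed d)
    (h : ∀ j ≤ m, y (k + j) - c = y' j) : PhiProd d k n y = PhiProd d 0 m y' := by
  subst hn
  symm
  refine Finset.prod_bij (fun i _ => k + i) ?_ ?_ ?_ ?_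
  · intro i hi
    rw [Finset.mem_Icc] at *
    omega
  · intro i _ j _ hij
    omega
  · intro i hi
    rw [Finset.mem_Icc] at hi
    exact ⟨i - k, by rw [Finset.mem_Icc]; omega, by omega⟩
  · intro i hi
    rw [Finset.mem_Icc] at hi
    rw [← h i hi.2, ← h (i - 1) (by omega), show k + (i - 1) = k + i - 1 by omega,
      sub_sub_sub_cancel_right]

/-- Translation invariance of `K` in space and in the index. -/
theorem Ksaw_shift {d : ℕ} {lam ρ : ℝ} {k m n : ℕ} (hn : n = k + m) {y y' : ℕ → Ed d} (c : Ed d)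
    (h : ∀ j ≤ m, y (k + j) - c = y' j) : Ksaw d lam ρ k n y = Ksaw d lam ρ 0 m y' := by
  subst hn
  symm
  refine Finset.prod_bij (fun p _ => (k + p.1, k + p.2)) ?_ ?_ ?_ ?_
  · intro p hp
    simp only [mem_filter, mem_product, Finset.mem_Icc] at *
    omega
  · intro p _ q _ hpq
    simp only [Prod.mk.injEq] at hpq
    ext <;> omega
  · intro p hp
    simp only [mem_filter, mem_product, Finset.mem_Icc] at hp
    refine ⟨(p.1 - k, p.2 - k), ?_, ?_⟩
    · simp only [mem_filter, mem_product, Finset.mem_Icc]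
      omega
    · ext <;> simp only <;> omega
  · intro p hp
    simp only [mem_filter, mem_product, Finset.mem_Icc] at hp
    rw [← h p.1 (by omega), ← h p.2 (by omega), sub_sub_sub_cancel_right]

theorem measurable_indBall (d : ℕ) (ρ : ℝ) : Measurable (indBall d ρ) :=
  Measurable.ite (measurableSet_le measurable_norm measurable_const) measurable_const
    measurable_const

theorem measurable_Ksaw (d : ℕ) (lam ρ : ℝ) (a b : ℕ) : Measurable (Ksaw d lam ρ a b) := by
  have := measurable_indBall d ρ
  unfold Ksaw
  fun_prop

theorem measurable_Jsaw (d : ℕ) (lam ρ : ℝ) (a b : ℕ) : Measurable (Jsaw d lam ρ a b) := by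
  have := measurable_indBall d ρ
  unfold Jsaw
  fun_prop

theorem measurable_PhiProd (d a b : ℕ) : Measurable (PhiProd d a b) := by
  have := (continuous_gauss d 1).measurable
  unfold PhiProd
  fun_prop

theorem measurable_extPath (d L : ℕ) : Measurable (extPath d L) := by
  refine measurable_pi_lambda _ fun j => ?_
  unfold extPath
  split_ifs <;> fun_prop

theorem measurable_sawPath (d n : ℕ) (x : Ed d) : Measurable (sawPath d n x) := by
  refine measurable_pi_lambda _ fun j => ?_
  unfold sawPath
  split_ifs <;> fun_prop

theorem lam_mul_indBall_nonneg_le_one {d : ℕ} {lam ρ : ℝ} (h0 : 0 ≤ lam) (h1 : lam ≤ 1) (x : Ed d) :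
    0 ≤ lam * indBall d ρ x ∧ lam * indBall d ρ x ≤ 1 := by
  unfold indBall
  split_ifs <;> simp [h0, h1]

theorem abs_Ksaw_le_one {d : ℕ} {lam ρ : ℝ} (h0 : 0 ≤ lam) (h1 : lam ≤ 1) (a b : ℕ)
    (y : ℕ → Ed d) : |Ksaw d lam ρ a b y| ≤ 1 := by
  unfold Ksaw
  rw [Finset.abs_prod]
  refine Finset.prod_le_one (fun _ _ => abs_nonneg _) fun p _ => ?_
  have := lam_mul_indBall_nonneg_le_one (ρ := ρ) h0 h1 (y p.2 - y p.1)
  exact abs_le.2 ⟨by linarith, by linarith⟩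

theorem abs_Jsaw_le_card {d : ℕ} {lam ρ : ℝ} (h0 : 0 ≤ lam) (h1 : lam ≤ 1) (a b : ℕ)
    (y : ℕ → Ed d) : |Jsaw d lam ρ a b y| ≤ (connGraphs a b).card := by
  refine (Finset.abs_sum_le_sum_abs _ _).trans ?_
  rw [Finset.card_eq_sum_ones, Nat.cast_sum]
  refine Finset.sum_le_sum fun G _ => ?_
  rw [Finset.abs_prod, Nat.cast_one]
  refine Finset.prod_le_one (fun _ _ => abs_nonneg _) fun p _ => ?_
  have := lam_mul_indBall_nonneg_le_one (ρ := ρ) h0 h1 (y p.2 - y p.1)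
  exact abs_le.2 ⟨by linarith, by linarith⟩

theorem PhiProd_nonneg (d a b : ℕ) (y : ℕ → Ed d) : 0 ≤ PhiProd d a b y :=
  Finset.prod_nonneg fun _ _ => gauss_one_nonneg d _

theorem PhiProd_extPath_cons (d m : ℕ) (y : Ed d) (v : Fin m → Ed d) :
    PhiProd d 0 (m + 1) (extPath d (m + 1) (Fin.cons y v)) =
      gauss d 1 y * PhiProd d 0 m (extPath d m (v - fun _ => y)) := by
  rw [← PhiProd_mul_PhiProd (b := 1) (by omega) (by omega)]
  congr 1
  · simp [PhiProd, extPath_cons_one, extPath_zero]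
  · refine PhiProd_shift (add_comm m 1) y fun j hj => ?_
    obtain _ | j := j
    · simp [extPath_cons_one, extPath_zero]
    · rw [extPath_sub_const d m v y (by omega) hj, show 1 + (j + 1) = j + 2 by omega,
        extPath_cons_add_two]

theorem measurePreserving_fin_cons (d m : ℕ) :
    MeasurePreserving
      (fun q : Ed d × (Fin m → Ed d) => (Fin.cons q.1 q.2 : Fin (m + 1) → Ed d)) := by
  have h := (volume_preserving_piFinSuccAbove (fun _ : Fin (m + 1) => Ed d) 0).symm
  have heq : (fun q : Ed d × (Fin m → Ed d) => (Fin.cons q.1 q.2 : Fin (m + 1) → Ed d)) =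
      (MeasurableEquiv.piFinSuccAbove (fun _ : Fin (m + 1) => Ed d) 0).symm := by
    funext q
    exact (Fin.insertNth_zero' q.1 q.2).symm
  rwa [← heq] at h

theorem measurePreserving_fin_append (d a b : ℕ) :
    MeasurePreserving (fun q : (Fin a → Ed d) × (Fin b → Ed d) => Fin.append q.1 q.2) := by
  have h := (volume_measurePreserving_piCongrLeft (fun _ : Fin (a + b) => Ed d)
    finSumFinEquiv).comp
    (volume_measurePreserving_sumPiEquivProdPi_symm (fun _ : Fin a ⊕ Fin b => Ed d))
  refine (congrArg (fun f => MeasurePreserving f volume volume) ?_).mpr h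
  funext q i
  obtain ⟨i, rfl⟩ := finSumFinEquiv.surjective i
  simp only [Function.comp, MeasurableEquiv.coe_piCongrLeft, Equiv.piCongrLeft_apply_apply]
  rcases i with i | i <;> simp [MeasurableEquiv.sumPiEquivProdPi]

theorem integrable_PhiProd_extPath (d m : ℕ) :
    Integrable fun z : Fin m → Ed d => PhiProd d 0 m (extPath d m z) := by
  induction m with
  | zero => simp [PhiProd]
  | succ m ih =>
    have hmeas : Measurable fun z : Fin (m + 1) → Ed d =>
        PhiProd d 0 (m + 1) (extPath d (m + 1) z) :=
      (measurable_PhiProd d 0 (m + 1)).comp (measurable_extPath d (m + 1))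
    have hmp := measurePreserving_fin_cons d m
    rw [← hmp.map_eq]
    rw [integrable_map_measure hmeas.aestronglyMeasurable hmp.aemeasurable, Measure.volume_eq_prod,
      integrable_prod_iff (hmeas.comp hmp.measurable).aestronglyMeasurable]
    simp only [Function.comp, PhiProd_extPath_cons]
    refine ⟨ae_of_all _ fun y => (ih.comp_sub_right _).const_mul _, ?_⟩
    simp only [norm_mul]
    simp_rw [integral_const_mul]
    simp_rw [integral_sub_right_eq_self fun v : Fin m → Ed d => ‖PhiProd d 0 m (extPath d m v)‖]
    exact (integrable_gauss_one d).norm.mul_const _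

theorem integrable_mul_PhiProd_sawPath {d m : ℕ} (x : Ed d) {A : (ℕ → Ed d) → ℝ}
    (hA : Measurable A) {C : ℝ} (hC : ∀ y, |A y| ≤ C) :
    Integrable fun z : Fin m → Ed d => A (sawPath d (m + 1) x (extPath d m z)) *
      PhiProd d 0 (m + 1) (sawPath d (m + 1) x (extPath d m z)) := by
  have hpath : Measurable fun z : Fin m → Ed d => sawPath d (m + 1) x (extPath d m z) :=
    (measurable_sawPath d (m + 1) x).comp (measurable_extPath d m)
  refine Integrable.bdd_mul ?_ (hA.comp hpath).aestronglyMeasurable (ae_of_all _ fun z => hC _)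
  refine ((integrable_PhiProd_extPath d m).mul_const ((2 * Real.pi * 1) ^ (-(d : ℝ) / 2))).mono'
    ((measurable_PhiProd d 0 (m + 1)).comp hpath).aestronglyMeasurable (ae_of_all _ fun z => ?_)
  rw [Real.norm_of_nonneg (PhiProd_nonneg _ _ _ _),
    ← PhiProd_mul_PhiProd (Nat.zero_le m) (Nat.le_succ m)]
  refine mul_le_mul (le_of_eq ?_) ?_ (PhiProd_nonneg _ _ _ _) (PhiProd_nonneg _ _ _ _)
  · refine PhiProd_congr fun j hj => ?_
    unfold sawPath
    by_cases h0 : j = 0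
    · simp [h0, extPath_zero]
    · rw [if_neg h0, if_neg (by omega)]
  · simp only [PhiProd, Nat.succ_eq_add_one, Finset.Icc_self, Finset.prod_singleton]
    exact gauss_one_le d _

theorem integral_fin_zero (d : ℕ) (f : (Fin 0 → Ed d) → ℝ) : ∫ z, f z = f 0 := by
  rw [volume_pi, Measure.pi_of_empty _ 0, integral_dirac]

/-- Splitting the path integral at time `a + 1` produces a convolution. -/
theorem integral_sawPath_split {d : ℕ} {lam ρ : ℝ} (h0 : 0 ≤ lam) (h1 : lam ≤ 1) {a b m : ℕ}
    (hm : m = a + (b + 1)) (x : Ed d) {A : (ℕ → Ed d) → ℝ} (hA : Measurable A) {C : ℝ}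
    (hC : ∀ y, |A y| ≤ C)
    (hcongr : ∀ y y' : ℕ → Ed d, (∀ j ≤ a + 1, y j = y' j) → A y = A y') :
    Integrable (fun z : Fin m → Ed d => A (sawPath d (m + 1) x (extPath d m z)) *
      Ksaw d lam ρ (a + 1) (m + 1) (sawPath d (m + 1) x (extPath d m z)) *
      PhiProd d 0 (m + 1) (sawPath d (m + 1) x (extPath d m z))) ∧
    ∫ z : Fin m → Ed d, A (sawPath d (m + 1) x (extPath d m z)) *
      Ksaw d lam ρ (a + 1) (m + 1) (sawPath d (m + 1) x (extPath d m z)) *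
      PhiProd d 0 (m + 1) (sawPath d (m + 1) x (extPath d m z)) =
    convl d (fun y => ∫ u : Fin a → Ed d, A (sawPath d (a + 1) y (extPath d a u)) *
      PhiProd d 0 (a + 1) (sawPath d (a + 1) y (extPath d a u))) (Csaw d lam ρ (b + 1)) x := by
  subst hm
  have hFint := integrable_mul_PhiProd_sawPath (m := a + (b + 1)) x
    (hA.mul (measurable_Ksaw d lam ρ (a + 1) (a + (b + 1) + 1))) (C := C * 1) (fun y => by
      simp only [Pi.mul_apply]
      rw [abs_mul]
      exact mul_le_mul (hC y) (abs_Ksaw_le_one h0 h1 _ _ y) (abs_nonneg _)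
        ((abs_nonneg _).trans (hC y)))
  simp only [Pi.mul_apply] at hFint
  refine ⟨hFint, ?_⟩
  set F : (Fin (a + (b + 1)) → Ed d) → ℝ := fun z =>
    A (sawPath d (a + (b + 1) + 1) x (extPath d (a + (b + 1)) z)) *
      Ksaw d lam ρ (a + 1) (a + (b + 1) + 1)
        (sawPath d (a + (b + 1) + 1) x (extPath d (a + (b + 1)) z)) *
      PhiProd d 0 (a + (b + 1) + 1)
        (sawPath d (a + (b + 1) + 1) x (extPath d (a + (b + 1)) z)) with hF
  have hFsplit : ∀ (u : Fin a → Ed d) (y : Ed d) (v : Fin b → Ed d),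
      F (Fin.append u (Fin.cons y v)) =
        (A (sawPath d (a + 1) y (extPath d a u)) *
          PhiProd d 0 (a + 1) (sawPath d (a + 1) y (extPath d a u))) *
        (Ksaw d lam ρ 0 (b + 1) (sawPath d (b + 1) (x - y) (extPath d b (v - fun _ => y))) *
          PhiProd d 0 (b + 1) (sawPath d (b + 1) (x - y) (extPath d b (v - fun _ => y)))) := by
    intro u y v
    simp only [hF]
    have hr := fun (i : ℕ) (hi : i ≤ b + 1) => sawPath_append_cons_right d a b x y u v hi
    have hl := fun (j : ℕ) (hj : j ≤ a + 1) => sawPath_append_cons_left d a b x y u v hj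
    rw [← PhiProd_mul_PhiProd (b := a + 1) (by omega) (by omega), hcongr _ _ hl,
      PhiProd_congr hl, Ksaw_shift (by omega) y hr, PhiProd_shift (by omega) y hr]
    ring
  have hmp : MeasurePreserving (fun q : (Fin a → Ed d) × (Ed d × (Fin b → Ed d)) =>
      Fin.append q.1 (Fin.cons q.2.1 q.2.2 : Fin (b + 1) → Ed d)) :=
    (measurePreserving_fin_append d a (b + 1)).comp
      ((MeasurePreserving.id volume).prod (measurePreserving_fin_cons d b))
  have hglueInt := hmp.integrable_comp_of_integrable hFint
  have hglue : ∫ z, F z = ∫ q : (Fin a → Ed d) × (Ed d × (Fin b → Ed d)),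
      (F ∘ fun q => Fin.append q.1 (Fin.cons q.2.1 q.2.2 : Fin (b + 1) → Ed d)) q := by
    rw [← hmp.map_eq, integral_map hmp.aemeasurable (by rw [hmp.map_eq]; exact hFint.1)]
    rfl
  rw [hglue, Measure.volume_eq_prod, integral_prod_symm _ hglueInt, Measure.volume_eq_prod,
    integral_prod _ hglueInt.integral_prod_right]
  simp only [Function.comp, hFsplit, integral_mul_const, integral_const_mul]
  refine integral_congr_ae (ae_of_all _ fun y => ?_)
  simp only
  rw [integral_sub_right_eq_self fun v : Fin b → Ed d =>
    Ksaw d lam ρ 0 (b + 1) (sawPath d (b + 1) (x - y) (extPath d b v)) *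
      PhiProd d 0 (b + 1) (sawPath d (b + 1) (x - y) (extPath d b v))]
  rfl

theorem convl_comm (d : ℕ) (f g : Ed d → ℝ) (x : Ed d) : convl d f g x = convl d g f x := by
  unfold convl
  rw [← integral_sub_left_eq_self _ volume x]
  simp only [sub_sub_cancel, mul_comm]

theorem Ksaw_self (d : ℕ) (lam ρ : ℝ) (n : ℕ) (y : ℕ → Ed d) : Ksaw d lam ρ n n y = 1 := by
  refine Finset.prod_eq_one fun p hp => ?_
  simp only [Finset.Icc_self, mem_filter, mem_product, Finset.mem_singleton] at hp
  omega

/-- The lace-expansion recursion for the connectivity functions of the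
weakly self-avoiding walk. -/
theorem saw_lace_recursion (d : ℕ) (hd : 1 ≤ d) (lam ρ : ℝ)
    (hlam0 : 0 ≤ lam) (hlam1 : lam ≤ 1) (hρ : 0 < ρ) (hρ1 : ρ ≤ 1) :
    (∀ x : Ed d, Csaw d lam ρ 1 x = gauss d 1 x + Pisaw d lam ρ 1 x) ∧
    ∀ n : ℕ, 2 ≤ n → ∀ x : Ed d,
      Csaw d lam ρ n x =
        convl d (Csaw d lam ρ (n - 1)) (gauss d 1) x +
          ((∑ k ∈ Finset.Icc 1 (n - 1),
            convl d (Pisaw d lam ρ k) (Csaw d lam ρ (n - k)) x) +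
            Pisaw d lam ρ n x) := by
  constructor
  · intro x
    have hJ := Ksaw_eq_add_sum d lam ρ 1 (sawPath d 1 x (extPath d 0 0))
    simp only [Finset.Icc_self, Finset.sum_singleton, Ksaw_self, mul_one] at hJ
    have hC : Csaw d lam ρ 1 x = _ := integral_fin_zero d _
    have hPi : Pisaw d lam ρ 1 x = _ := integral_fin_zero d _
    rw [hC, hPi, hJ, add_mul, one_mul]
    simp [PhiProd, sawPath]
  · intro n hn x
    obtain ⟨m, rfl⟩ : ∃ m, n = m + 1 + 1 := ⟨n - 2, by omega⟩
    have hfirst := integral_sawPath_split (ρ := ρ) hlam0 hlam1 (zero_add (m + 1)).symm x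
      (A := fun _ => 1) measurable_const (C := 1) (fun _ => by simp) (fun _ _ _ => rfl)
    have hterm : ∀ k ∈ Finset.Icc 1 (m + 1),
        Integrable (fun z : Fin (m + 1) → Ed d =>
          Jsaw d lam ρ 0 k (sawPath d (m + 1 + 1) x (extPath d (m + 1) z)) *
          Ksaw d lam ρ k (m + 1 + 1) (sawPath d (m + 1 + 1) x (extPath d (m + 1) z)) *
          PhiProd d 0 (m + 1 + 1) (sawPath d (m + 1 + 1) x (extPath d (m + 1) z))) ∧
        ∫ z : Fin (m + 1) → Ed d,
          Jsaw d lam ρ 0 k (sawPath d (m + 1 + 1) x (extPath d (m + 1) z)) *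
          Ksaw d lam ρ k (m + 1 + 1) (sawPath d (m + 1 + 1) x (extPath d (m + 1) z)) *
          PhiProd d 0 (m + 1 + 1) (sawPath d (m + 1 + 1) x (extPath d (m + 1) z)) =
        convl d (Pisaw d lam ρ k) (Csaw d lam ρ (m + 1 + 1 - k)) x := by
      intro k hk
      rw [Finset.mem_Icc] at hk
      obtain ⟨a, rfl⟩ : ∃ a, k = a + 1 := ⟨k - 1, by omega⟩
      obtain ⟨b, hb⟩ : ∃ b, m + 1 = a + (b + 1) := ⟨m - a, by omega⟩
      rw [show m + 1 + 1 - (a + 1) = b + 1 by omega]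
      exact integral_sawPath_split hlam0 hlam1 hb x (measurable_Jsaw d lam ρ 0 (a + 1))
        (abs_Jsaw_le_card hlam0 hlam1 0 (a + 1)) (fun _ _ h => Jsaw_congr h)
    have hlast := integrable_mul_PhiProd_sawPath (m := m + 1) x
      (measurable_Jsaw d lam ρ 0 (m + 1 + 1)) (abs_Jsaw_le_card hlam0 hlam1 0 (m + 1 + 1))
    simp only [Nat.zero_add, one_mul] at hfirst
    rw [convl_comm]
    have hgauss : (fun y => ∫ u : Fin 0 → Ed d,
        PhiProd d 0 1 (sawPath d 1 y (extPath d 0 u))) = gauss d 1 := by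
      funext y
      rw [integral_fin_zero]
      simp [PhiProd, sawPath]
    rw [hgauss] at hfirst
    simp only [Nat.add_sub_cancel]
    rw [← hfirst.2, ← Finset.sum_congr rfl fun k hk => (hterm k hk).2,
      ← integral_finsetSum _ fun k hk => (hterm k hk).1]
    have hC : Csaw d lam ρ (m + 1 + 1) x = ∫ z : Fin (m + 1) → Ed d,
        Ksaw d lam ρ 0 (m + 1 + 1) (sawPath d (m + 1 + 1) x (extPath d (m + 1) z)) *
          PhiProd d 0 (m + 1 + 1) (sawPath d (m + 1 + 1) x (extPath d (m + 1) z)) := rfl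
    have hPi : Pisaw d lam ρ (m + 1 + 1) x = ∫ z : Fin (m + 1) → Ed d,
        Jsaw d lam ρ 0 (m + 1 + 1) (sawPath d (m + 1 + 1) x (extPath d (m + 1) z)) *
          PhiProd d 0 (m + 1 + 1) (sawPath d (m + 1 + 1) x (extPath d (m + 1) z)) := rfl
    rw [hC, hPi]
    rw [← integral_add (integrable_finsetSum _ fun k hk => (hterm k hk).1) hlast,
      ← integral_add hfirst.1
        ((integrable_finsetSum _ fun k hk => (hterm k hk).1).fun_add hlast)]
    refine integral_congr_ae (ae_of_all _ fun z => ?_)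
    simp only
    rw [Ksaw_eq_add_sum, Finset.sum_Icc_succ_top (by omega), Ksaw_self, add_mul, add_mul,
      Finset.sum_mul, mul_one]
end
end
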